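/- Let K, σ, T > 0, r ∈ ℝ, 0 ≤ t < T and s > 0. With d₁ = (log(s/K) + (r + σ²/2)(T−t))/(σ√(T−t)) and d₂ = d₁ − σ√(T−t), the Black–Scholes call price C(t,s) = s·Φ(d₁) − K·e^{−r(T−t)}·Φ(d₂) and put price P(t,s) = K·e^{−r(T−t)}·Φ(−d₂) − s·Φ(−d₁) satisfy ∂C/∂s (t,s) = Φ(d₁) and ∂P/∂s (t,s) = −Φ(−d₁) = Φ(d₁) − 1 (the Black–Scholes Delta formulas). -/

import Mathlib

open Real MeasureTheory

/-- The standard normal cumulative distribution function. -/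
noncomputable def Phi (x : ℝ) : ℝ :=
  (Real.sqrt (2 * Real.pi))⁻¹ * ∫ y in Set.Iio x, Real.exp (-(y ^ 2) / 2)

/-- `d₁` of the Black–Scholes formula as a function of the asset price `s`. -/
noncomputable def d1 (K σ T r t s : ℝ) : ℝ :=
  (Real.log (s / K) + (r + σ ^ 2 / 2) * (T - t)) / (σ * Real.sqrt (T - t))

/-- `d₂` of the Black–Scholes formula as a function of the asset price `s`. -/
noncomputable def d2 (K σ T r t s : ℝ) : ℝ :=
  d1 K σ T r t s - σ * Real.sqrt (T - t)

/-- The Black–Scholes call price as a function of the asset price `s`. -/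
noncomputable def callBS (K σ T r t s : ℝ) : ℝ :=
  s * Phi (d1 K σ T r t s) - K * Real.exp (-r * (T - t)) * Phi (d2 K σ T r t s)

/-- The Black–Scholes put price as a function of the asset price `s`. -/
noncomputable def putBS (K σ T r t s : ℝ) : ℝ :=
  K * Real.exp (-r * (T - t)) * Phi (-(d2 K σ T r t s)) - s * Phi (-(d1 K σ T r t s))

lemma integrable_exp_neg_sq_div_two : Integrable (fun y : ℝ => Real.exp (-(y ^ 2) / 2)) := by
  convert integrable_exp_neg_mul_sq (show (0 : ℝ) < 1 / 2 by norm_num) using 3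
  ring

/-- The derivative of the standard normal distribution function is the standard normal density. -/
lemma hasDerivAt_Phi (x : ℝ) :
    HasDerivAt Phi ((Real.sqrt (2 * Real.pi))⁻¹ * Real.exp (-(x ^ 2) / 2)) x := by
  have hcont : Continuous (fun y : ℝ => Real.exp (-(y ^ 2) / 2)) := by fun_prop
  have hPhi : Phi = fun x => (Real.sqrt (2 * Real.pi))⁻¹ *
      ((∫ y in (0 : ℝ)..x, Real.exp (-(y ^ 2) / 2)) +
        ∫ y in Set.Iic (0 : ℝ), Real.exp (-(y ^ 2) / 2)) := by
    funext z
    rw [← intervalIntegral.integral_Iic_sub_Iic integrable_exp_neg_sq_div_two.integrableOn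
      integrable_exp_neg_sq_div_two.integrableOn, sub_add_cancel, integral_Iic_eq_integral_Iio, Phi]
  rw [hPhi]
  exact ((intervalIntegral.integral_hasDerivAt_right (hcont.intervalIntegrable _ _)
    (hcont.stronglyMeasurableAtFilter _ _) hcont.continuousAt).add_const _).const_mul _

lemma Phi_neg (x : ℝ) : Phi (-x) = 1 - Phi x := by
  have hreflect : ∫ y in Set.Iio (-x), Real.exp (-(y ^ 2) / 2) =
      ∫ y in Set.Ioi x, Real.exp (-(y ^ 2) / 2) := by
    rw [← integral_Iic_eq_integral_Iio, ← integral_comp_neg_Ioi]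
    simp
  have htotal : (∫ y in Set.Iio x, Real.exp (-(y ^ 2) / 2)) +
      ∫ y in Set.Ioi x, Real.exp (-(y ^ 2) / 2) = Real.sqrt (2 * Real.pi) := by
    rw [← integral_Iic_eq_integral_Iio,
      intervalIntegral.integral_Iic_add_Ioi integrable_exp_neg_sq_div_two.integrableOn
        integrable_exp_neg_sq_div_two.integrableOn]
    have hgauss := integral_gaussian (1 / 2)
    rw [show Real.pi / (1 / 2) = 2 * Real.pi by ring] at hgauss
    rw [← hgauss]
    congr 1 with y
    ring_nf
  have hpos : Real.sqrt (2 * Real.pi) ≠ 0 := by positivity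
  rw [Phi, Phi, hreflect, eq_sub_of_add_eq' htotal]
  field_simp

lemma hasDerivAt_d1 (K σ T r t s : ℝ) (hK : 0 < K) (hs : 0 < s) :
    HasDerivAt (d1 K σ T r t) (1 / s / (σ * Real.sqrt (T - t))) s := by
  have hlog := ((hasDerivAt_id s).div_const K).log (div_pos hs hK).ne'
  refine ((hlog.add_const ((r + σ ^ 2 / 2) * (T - t))).div_const
    (σ * Real.sqrt (T - t))).congr_deriv ?_
  congr 1
  simp only [id]
  field_simp

/-- The identity `s φ(d₁) = K e^{-r(T-t)} φ(d₂)` for the Gaussian weight `φ`. -/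
lemma mul_exp_d1_eq (K σ T r t s : ℝ) (hK : 0 < K) (hσ : 0 < σ) (ht : t < T) (hs : 0 < s) :
    s * Real.exp (-(d1 K σ T r t s ^ 2) / 2) =
      K * Real.exp (-r * (T - t)) * Real.exp (-(d2 K σ T r t s ^ 2) / 2) := by
  have hτ : 0 < T - t := sub_pos.mpr ht
  have hmul : d1 K σ T r t s * (σ * Real.sqrt (T - t)) =
      Real.log (s / K) + (r + σ ^ 2 / 2) * (T - t) :=
    div_mul_cancel₀ _ (by positivity)
  have hexp : -r * (T - t) + -(d2 K σ T r t s ^ 2) / 2 =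
      Real.log (s / K) + -(d1 K σ T r t s ^ 2) / 2 := by
    rw [d2]
    linear_combination hmul - σ ^ 2 / 2 * Real.sq_sqrt hτ.le
  rw [mul_assoc, ← Real.exp_add, hexp, Real.exp_add, Real.exp_log (div_pos hs hK)]
  field_simp

lemma hasDerivAt_callBS (K σ T r t s : ℝ) (hK : 0 < K) (hσ : 0 < σ) (ht : t < T) (hs : 0 < s) :
    HasDerivAt (callBS K σ T r t) (Phi (d1 K σ T r t s)) s := by
  have hd1 := hasDerivAt_d1 K σ T r t s hK hs
  have hd2 : HasDerivAt (d2 K σ T r t) _ s := hd1.sub_const (σ * Real.sqrt (T - t))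
  have hcall := ((hasDerivAt_id s).mul ((hasDerivAt_Phi _).comp s hd1)).sub
    (((hasDerivAt_Phi _).comp s hd2).const_mul (K * Real.exp (-r * (T - t))))
  refine hcall.congr_deriv ?_
  simp only [id, Function.comp_apply]
  linear_combination (Real.sqrt (2 * Real.pi))⁻¹ * (1 / s / (σ * Real.sqrt (T - t))) *
    mul_exp_d1_eq K σ T r t s hK hσ ht hs

/-- Put–call parity. -/
lemma putBS_eq_callBS_add (K σ T r t s : ℝ) :
    putBS K σ T r t s = callBS K σ T r t s + K * Real.exp (-r * (T - t)) - s := by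
  rw [putBS, callBS, Phi_neg, Phi_neg]
  ring

/-- The Black–Scholes Delta formulas: `∂C/∂s = Φ(d₁)` and
`∂P/∂s = −Φ(−d₁) = Φ(d₁) − 1`. -/
theorem black_scholes_delta
    (K σ T r t s : ℝ) (hK : 0 < K) (hσ : 0 < σ) (hT : 0 < T)
    (ht₀ : 0 ≤ t) (ht : t < T) (hs : 0 < s) :
    HasDerivAt (fun s' => callBS K σ T r t s') (Phi (d1 K σ T r t s)) s ∧
    HasDerivAt (fun s' => putBS K σ T r t s') (-Phi (-(d1 K σ T r t s))) s ∧
    -Phi (-(d1 K σ T r t s)) = Phi (d1 K σ T r t s) - 1 := by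
  have hneg : -Phi (-(d1 K σ T r t s)) = Phi (d1 K σ T r t s) - 1 := by
    rw [Phi_neg]
    ring
  have hcall := hasDerivAt_callBS K σ T r t s hK hσ ht hs
  refine ⟨hcall, ?_, hneg⟩
  simp only [hneg, putBS_eq_callBS_add]
  exact (hcall.add_const _).sub (hasDerivAt_id s)
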